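/- If the 4×4 complex Hermitian matrix Q is positive semidefinite, then E₀² ≥ A − 4√2·√D + √(F₊). (In the paper this is derived from the nonnegativity of the determinant of Q together with an upper bound on det Q.) -/

import Mathlib

noncomputable section

open Matrix
open scoped ComplexOrder

/-- Euclidean dot product on ℝ³. -/
def dot3 (u v : Fin 3 → ℝ) : ℝ := u 0 * v 0 + u 1 * v 1 + u 2 * v 2

/-- Cross product on ℝ³. -/
def cross3 (u v : Fin 3 → ℝ) : Fin 3 → ℝ :=
  ![u 1 * v 2 - u 2 * v 1, u 2 * v 0 - u 0 * v 2, u 0 * v 1 - u 1 * v 0]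

/-- Euclidean norm on ℝ³. -/
def norm3 (u : Fin 3 → ℝ) : ℝ := Real.sqrt (dot3 u u)

/-- The 4×4 Hermitian matrix Q = [[E, L], [L*, Ê]] from the positive energy theorem. -/
def Qmat (E₀ c₁ c₂ c₃ c₄ c₁' c₂' c₃' c₄' J₁₂ J₁₃ J₂₃ J₁₄ J₂₄ J₃₄ : ℝ) :
    Matrix (Fin 4) (Fin 4) ℂ :=
  !![((E₀ + c₄ + c₃' - J₃₄ : ℝ) : ℂ),
     (c₁' : ℂ) + Complex.I * (c₂' : ℂ) - (J₁₄ : ℂ) - Complex.I * (J₂₄ : ℂ),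
     (c₃ : ℂ) - (c₄' : ℂ) + Complex.I * (J₁₂ : ℂ),
     (c₁ : ℂ) + Complex.I * (c₂ : ℂ) + (J₁₃ : ℂ) + Complex.I * (J₂₃ : ℂ);
     (c₁' : ℂ) - Complex.I * (c₂' : ℂ) - (J₁₄ : ℂ) + Complex.I * (J₂₄ : ℂ),
     ((E₀ + c₄ - c₃' + J₃₄ : ℝ) : ℂ),
     (c₁ : ℂ) - Complex.I * (c₂ : ℂ) - (J₁₃ : ℂ) + Complex.I * (J₂₃ : ℂ),
     -(c₃ : ℂ) - (c₄' : ℂ) - Complex.I * (J₁₂ : ℂ);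
     (c₃ : ℂ) - (c₄' : ℂ) - Complex.I * (J₁₂ : ℂ),
     (c₁ : ℂ) + Complex.I * (c₂ : ℂ) - (J₁₃ : ℂ) - Complex.I * (J₂₃ : ℂ),
     ((E₀ - c₄ - c₃' - J₃₄ : ℝ) : ℂ),
     -(c₁' : ℂ) - Complex.I * (c₂' : ℂ) - (J₁₄ : ℂ) - Complex.I * (J₂₄ : ℂ);
     (c₁ : ℂ) - Complex.I * (c₂ : ℂ) + (J₁₃ : ℂ) - Complex.I * (J₂₃ : ℂ),
     -(c₃ : ℂ) - (c₄' : ℂ) + Complex.I * (J₁₂ : ℂ),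
     -(c₁' : ℂ) + Complex.I * (c₂' : ℂ) - (J₁₄ : ℂ) + Complex.I * (J₂₄ : ℂ),
     ((E₀ - c₄ + c₃' + J₃₄ : ℝ) : ℂ)]

theorem dot3_self_nonneg (u : Fin 3 → ℝ) : 0 ≤ dot3 u u := by
  unfold dot3
  nlinarith [sq_nonneg (u 0), sq_nonneg (u 1), sq_nonneg (u 2)]

theorem norm3_sq (u : Fin 3 → ℝ) : norm3 u ^ 2 = dot3 u u :=
  Real.sq_sqrt (dot3_self_nonneg u)

theorem dot3_add_dot3_sq_le (u v x y : Fin 3 → ℝ) :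
    (dot3 u v + dot3 x y) ^ 2 ≤ (dot3 u u + dot3 x x) * (dot3 v v + dot3 y y) := by
  have h := Finset.sum_mul_sq_le_sq_mul_sq Finset.univ
    ![u 0, u 1, u 2, x 0, x 1, x 2] ![v 0, v 1, v 2, y 0, y 1, y 2]
  simp only [Fin.sum_univ_succ, Fin.succ_zero_eq_one] at h
  simp at h
  unfold dot3
  linarith

set_option maxRecDepth 10000 in
theorem det_Qmat (E₀ c₁ c₂ c₃ c₄ c₁' c₂' c₃' c₄' J₁₂ J₁₃ J₂₃ J₁₄ J₂₄ J₃₄ : ℝ) :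
    (Qmat E₀ c₁ c₂ c₃ c₄ c₁' c₂' c₃' c₄' J₁₂ J₁₃ J₂₃ J₁₄ J₂₄ J₃₄).det =
      ((E₀ ^ 4 - 2 * (c₄ ^ 2 + c₄' ^ 2 + dot3 ![c₁, c₂, c₃] ![c₁, c₂, c₃]
        + dot3 ![c₁', c₂', c₃'] ![c₁', c₂', c₃'] + dot3 ![J₂₃, -J₁₃, J₁₂] ![J₂₃, -J₁₃, J₁₂]
        + dot3 ![J₁₄, J₂₄, J₃₄] ![J₁₄, J₂₄, J₃₄]) * E₀ ^ 2
        - 8 * (dot3 ![c₄ * c₁' - c₄' * c₁, c₄ * c₂' - c₄' * c₂, c₄ * c₃' - c₄' * c₃]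
          ![J₁₄, J₂₄, J₃₄] + dot3 (cross3 ![c₁, c₂, c₃] ![J₂₃, -J₁₃, J₁₂]) ![c₁', c₂', c₃']) * E₀
        + (c₄ ^ 2 + c₄' ^ 2 + dot3 ![c₁, c₂, c₃] ![c₁, c₂, c₃]
          + dot3 ![c₁', c₂', c₃'] ![c₁', c₂', c₃']
          + dot3 ![J₂₃, -J₁₃, J₁₂] ![J₂₃, -J₁₃, J₁₂] + dot3 ![J₁₄, J₂₄, J₃₄] ![J₁₄, J₂₄, J₃₄]) ^ 2
        - (4 * dot3 (cross3 ![c₁, c₂, c₃] ![J₂₃, -J₁₃, J₁₂]) (cross3 ![c₁, c₂, c₃]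
          ![J₂₃, -J₁₃, J₁₂])
          + 4 * dot3 (cross3 ![c₁, c₂, c₃] ![c₁', c₂', c₃']) (cross3 ![c₁, c₂, c₃] ![c₁', c₂', c₃'])
          + 4 * dot3 ![c₄ * c₁' - c₄' * c₁, c₄ * c₂' - c₄' * c₂, c₄ * c₃' - c₄' * c₃]
            ![c₄ * c₁' - c₄' * c₁, c₄ * c₂' - c₄' * c₂, c₄ * c₃' - c₄' * c₃]
          + 4 * (dot3 ![J₁₄, J₂₄, J₃₄] ![c₁', c₂', c₃'] ^ 2
            + dot3 ![J₁₄, J₂₄, J₃₄] ![J₂₃, -J₁₃, J₁₂] ^ 2 + dot3 ![J₁₄, J₂₄, J₃₄] ![c₁, c₂, c₃] ^ 2)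
          + 4 * dot3 (cross3 ![c₁', c₂', c₃'] ![J₂₃, -J₁₃, J₁₂]) (cross3 ![c₁', c₂', c₃']
            ![J₂₃, -J₁₃, J₁₂]) + 4 * dot3 ![J₁₄, J₂₄, J₃₄] ![J₁₄, J₂₄, J₃₄] * (c₄ ^ 2 + c₄' ^ 2)
          + 8 * c₄ * dot3 (cross3 ![c₁, c₂, c₃] ![J₂₃, -J₁₃, J₁₂]) ![J₁₄, J₂₄, J₃₄]
            + 8 * c₄' * dot3 (cross3 ![c₁', c₂', c₃'] ![J₂₃, -J₁₃, J₁₂]) ![J₁₄, J₂₄, J₃₄])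
            : ℝ) : ℂ) := by
  simp [Qmat, dot3, cross3, Matrix.det_succ_row_zero, Fin.sum_univ_succ, Fin.succAbove]
  ring_nf
  simp only [Complex.I_sq, Complex.I_pow_four]
  ring

theorem sum_det_principal_minors_Qmat (E₀ c₁ c₂ c₃ c₄ c₁' c₂' c₃' c₄' J₁₂ J₁₃ J₂₃ J₁₄ J₂₄ J₃₄ : ℝ) :
    ∑ i : Fin 4, ((Qmat E₀ c₁ c₂ c₃ c₄ c₁' c₂' c₃' c₄' J₁₂ J₁₃ J₂₃ J₁₄ J₂₄ J₃₄).submatrix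
        i.succAbove i.succAbove).det =
      ((4 * E₀ ^ 3 - 4 * (c₄ ^ 2 + c₄' ^ 2 + dot3 ![c₁, c₂, c₃] ![c₁, c₂, c₃]
        + dot3 ![c₁', c₂', c₃'] ![c₁', c₂', c₃'] + dot3 ![J₂₃, -J₁₃, J₁₂] ![J₂₃, -J₁₃, J₁₂]
        + dot3 ![J₁₄, J₂₄, J₃₄] ![J₁₄, J₂₄, J₃₄]) * E₀
        - 8 * (dot3 ![c₄ * c₁' - c₄' * c₁, c₄ * c₂' - c₄' * c₂, c₄ * c₃' - c₄' * c₃]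
          ![J₁₄, J₂₄, J₃₄]
          + dot3 (cross3 ![c₁, c₂, c₃] ![J₂₃, -J₁₃, J₁₂]) ![c₁', c₂', c₃']) : ℝ) : ℂ) := by
  simp [Qmat, dot3, cross3, Matrix.det_fin_three, Fin.sum_univ_succ, Fin.succAbove]
  ring_nf
  simp only [Complex.I_sq]
  ring

theorem abs_le_of_Qmat_posSemidef {E₀ c₁ c₂ c₃ c₄ c₁' c₂' c₃' c₄' J₁₂ J₁₃ J₂₃ J₁₄ J₂₄ J₃₄ : ℝ}
    (hQ : (Qmat E₀ c₁ c₂ c₃ c₄ c₁' c₂' c₃' c₄' J₁₂ J₁₃ J₂₃ J₁₄ J₂₄ J₃₄).PosSemidef) :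
    |c₄| ≤ E₀ := by
  have h₀ := hQ.diag_nonneg (i := 0)
  have h₁ := hQ.diag_nonneg (i := 1)
  have h₂ := hQ.diag_nonneg (i := 2)
  have h₃ := hQ.diag_nonneg (i := 3)
  simp only [Qmat, Matrix.of_apply, Matrix.cons_val, Complex.zero_le_real] at h₀ h₁ h₂ h₃
  exact abs_le.mpr ⟨by linarith, by linarith⟩

theorem dot3_add_dot3_le_of_Qmat_posSemidef {E₀ c₁ c₂ c₃ c₄ c₁' c₂' c₃' c₄' J₁₂ J₁₃ J₂₃ J₁₄ J₂₄ J₃₄ : ℝ}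
    (hQ : (Qmat E₀ c₁ c₂ c₃ c₄ c₁' c₂' c₃' c₄' J₁₂ J₁₃ J₂₃ J₁₄ J₂₄ J₃₄).PosSemidef) :
    dot3 ![J₁₄, J₂₄, J₃₄] ![J₁₄, J₂₄, J₃₄]
      + dot3 ![c₁', c₂', c₃'] ![c₁', c₂', c₃'] ≤ 2 * E₀ ^ 2 := by
  have h₁ := (hQ.submatrix ![0, 1]).det_nonneg
  have h₂ := (hQ.submatrix ![2, 3]).det_nonneg
  have e₁ : ((Qmat E₀ c₁ c₂ c₃ c₄ c₁' c₂' c₃' c₄' J₁₂ J₁₃ J₂₃ J₁₄ J₂₄ J₃₄).submatrix ![0, 1]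
    ![0, 1]).det =
      (((E₀ + c₄) ^ 2 - (c₁' - J₁₄) ^ 2 - (c₂' - J₂₄) ^ 2 - (c₃' - J₃₄) ^ 2 : ℝ) : ℂ) := by
    rw [Matrix.det_fin_two]
    simp [Qmat]
    ring_nf
    simp only [Complex.I_sq]
    ring
  have e₂ : ((Qmat E₀ c₁ c₂ c₃ c₄ c₁' c₂' c₃' c₄' J₁₂ J₁₃ J₂₃ J₁₄ J₂₄ J₃₄).submatrix ![2, 3]
    ![2, 3]).det =
      (((E₀ - c₄) ^ 2 - (c₁' + J₁₄) ^ 2 - (c₂' + J₂₄) ^ 2 - (c₃' + J₃₄) ^ 2 : ℝ) : ℂ) := by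
    rw [Matrix.det_fin_two]
    simp [Qmat]
    ring_nf
    simp only [Complex.I_sq]
    ring
  rw [e₁, Complex.zero_le_real] at h₁
  rw [e₂, Complex.zero_le_real] at h₂
  have h₃ : c₄ ^ 2 ≤ E₀ ^ 2 := sq_le_sq.mpr
    ((abs_le_of_Qmat_posSemidef hQ).trans (le_abs_self _))
  simp only [dot3, Matrix.cons_val]
  nlinarith

theorem sum_sq_eq_zero_of_Qmat_posSemidef {E₀ c₁ c₂ c₃ c₄ c₁' c₂' c₃' c₄' J₁₂ J₁₃ J₂₃ J₁₄ J₂₄ J₃₄ : ℝ}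
    (hQ : (Qmat E₀ c₁ c₂ c₃ c₄ c₁' c₂' c₃' c₄' J₁₂ J₁₃ J₂₃ J₁₄ J₂₄ J₃₄).PosSemidef) (hE : E₀ = 0) :
    c₄ ^ 2 + c₄' ^ 2 + dot3 ![c₁, c₂, c₃] ![c₁, c₂, c₃]
      + dot3 ![c₁', c₂', c₃'] ![c₁', c₂', c₃'] + dot3 ![J₂₃, -J₁₃, J₁₂] ![J₂₃, -J₁₃, J₁₂]
      + dot3 ![J₁₄, J₂₄, J₃₄] ![J₁₄, J₂₄, J₃₄] = 0 := by
  have htr : (Qmat E₀ c₁ c₂ c₃ c₄ c₁' c₂' c₃' c₄' J₁₂ J₁₃ J₂₃ J₁₄ J₂₄ J₃₄).trace = 0 := by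
    simp [Qmat, Matrix.trace, Fin.sum_univ_succ, hE]
    ring
  have h := hQ.trace_eq_zero_iff.mp htr
  have entry (i j : Fin 4) := congrFun (congrFun h i) j
  have h₀₀ := entry 0 0
  have h₁₁ := entry 1 1
  have h₂₂ := entry 2 2
  have h₀₁ := entry 0 1
  have h₀₂ := entry 0 2
  have h₀₃ := entry 0 3
  have h₁₂ := entry 1 2
  have h₁₃ := entry 1 3
  have h₂₃ := entry 2 3
  simp [Qmat, Complex.ext_iff, hE] at h₀₀ h₁₁ h₂₂ h₀₁ h₀₂ h₀₃ h₁₂ h₁₃ h₂₃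
  have z₁ : c₁ = 0 := by linarith
  have z₂ : c₂ = 0 := by linarith
  have z₃ : c₃ = 0 := by linarith
  have z₄ : c₄ = 0 := by linarith
  have z₁' : c₁' = 0 := by linarith
  have z₂' : c₂' = 0 := by linarith
  have z₃' : c₃' = 0 := by linarith
  have z₄' : c₄' = 0 := by linarith
  have z₁₂ : J₁₂ = 0 := by linarith
  have z₁₃ : J₁₃ = 0 := by linarith
  have z₂₃ : J₂₃ = 0 := by linarith
  have z₁₄ : J₁₄ = 0 := by linarith
  have z₂₄ : J₂₄ = 0 := by linarith
  have z₃₄ : J₃₄ = 0 := by linarith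
  simp [dot3, *]

/-- If the quartic `x ^ 4 - 2 * A * x ^ 2 - 8 * T * x + A ^ 2 - G` and its derivative are
nonnegative at `E ≥ 0`, then a bound on its linear coefficient gives a lower bound for `E ^ 2`. -/
theorem sq_ge_of_quartic_nonneg {E A D T G : ℝ} (hE : 0 ≤ E) (hA : E = 0 → A = 0)
    (hD : 0 ≤ D) (hT : T ^ 2 ≤ D * (2 * E ^ 2))
    (hderiv : 0 ≤ 4 * E ^ 3 - 4 * A * E - 8 * T)
    (hquartic : 0 ≤ E ^ 4 - 2 * A * E ^ 2 - 8 * T * E + A ^ 2 - G) :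
    A - 4 * √2 * √D + √(max (-8 * √2 * √D * A + 32 * D + G) 0) ≤ E ^ 2 := by
  obtain ⟨r, hr⟩ : ∃ r, r = √2 * √D := ⟨_, rfl⟩
  have hr₀ : 0 ≤ r := hr ▸ by positivity
  have hr₂ : r ^ 2 = 2 * D := by
    rw [hr, mul_pow, Real.sq_sqrt zero_le_two, Real.sq_sqrt hD]
  have hTr : |T| ≤ r * E := abs_le_of_sq_le_sq (by rw [mul_pow, hr₂]; linarith) (by positivity)
  obtain ⟨hT₁, hT₂⟩ := abs_le.mp hTr
  have hB : 0 ≤ E ^ 2 - (A - 4 * r) := by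
    rcases hE.eq_or_lt with h | h
    · rw [hA h.symm]
      nlinarith
    · refine nonneg_of_mul_nonneg_right ?_ h
      nlinarith [mul_nonneg hr₀ hE]
  have hmax : √(max (-8 * √2 * √D * A + 32 * D + G) 0) ≤ E ^ 2 - (A - 4 * r) := by
    refine Real.sqrt_le_iff.mpr ⟨hB, max_le ?_ (sq_nonneg _)⟩
    rw [mul_assoc (-8), ← hr]
    nlinarith [mul_le_mul_of_nonneg_right hT₁ hE]
  rw [mul_assoc 4, ← hr]
  linarith

theorem stmt5 (E₀ c₁ c₂ c₃ c₄ c₁' c₂' c₃' c₄' J₁₂ J₁₃ J₂₃ J₁₄ J₂₄ J₃₄ : ℝ)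
    (hQ : (Qmat E₀ c₁ c₂ c₃ c₄ c₁' c₂' c₃' c₄' J₁₂ J₁₃ J₂₃ J₁₄ J₂₄ J₃₄).PosSemidef) :
    E₀ ^ 2 ≥ (c₄ ^ 2 + c₄' ^ 2 + norm3 ![c₁, c₂, c₃] ^ 2 + norm3 ![c₁', c₂', c₃'] ^ 2 + norm3 ![J₂₃, -J₁₃, J₁₂] ^ 2 + norm3 ![J₁₄, J₂₄, J₃₄] ^ 2) - 4 * Real.sqrt 2 * Real.sqrt ((c₄ * c₁' - c₄' * c₁) ^ 2 + (c₄ * c₂' - c₄' * c₂) ^ 2 + (c₄ * c₃' - c₄' * c₃) ^ 2 + norm3 (cross3 ![c₁, c₂, c₃] ![J₂₃, -J₁₃, J₁₂]) ^ 2)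
      + Real.sqrt (max (-8 * Real.sqrt 2 * Real.sqrt ((c₄ * c₁' - c₄' * c₁) ^ 2 + (c₄ * c₂' - c₄' * c₂) ^ 2 + (c₄ * c₃' - c₄' * c₃) ^ 2 + norm3 (cross3 ![c₁, c₂, c₃] ![J₂₃, -J₁₃, J₁₂]) ^ 2) * (c₄ ^ 2 + c₄' ^ 2 + norm3 ![c₁, c₂, c₃] ^ 2 + norm3 ![c₁', c₂', c₃'] ^ 2 + norm3 ![J₂₃, -J₁₃, J₁₂] ^ 2 + norm3 ![J₁₄, J₂₄, J₃₄] ^ 2) + 36 * norm3 (cross3 ![c₁, c₂, c₃] ![J₂₃, -J₁₃, J₁₂]) ^ 2 + 4 * norm3 (cross3 ![c₁, c₂, c₃] ![c₁', c₂', c₃']) ^ 2 + 36 * ((c₄ * c₁' - c₄' * c₁) ^ 2 + (c₄ * c₂' - c₄' * c₂) ^ 2 + (c₄ * c₃' - c₄' * c₃) ^ 2) + 4 * (dot3 ![J₁₄, J₂₄, J₃₄] ![c₁', c₂', c₃'] ^ 2 + dot3 ![J₁₄, J₂₄, J₃₄] ![J₂₃, -J₁₃, J₁₂] ^ 2 +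 dot3 ![J₁₄, J₂₄, J₃₄] ![c₁, c₂, c₃] ^ 2) + 4 * norm3 (cross3 ![c₁', c₂', c₃'] ![J₂₃, -J₁₃, J₁₂]) ^ 2 + 4 * norm3 ![J₁₄, J₂₄, J₃₄] ^ 2 * (c₄ ^ 2 + c₄' ^ 2) + 8 * c₄ * dot3 (cross3 ![c₁, c₂, c₃] ![J₂₃, -J₁₃, J₁₂]) ![J₁₄, J₂₄, J₃₄] + 8 * c₄' * dot3 (cross3 ![c₁', c₂', c₃'] ![J₂₃, -J₁₃, J₁₂]) ![J₁₄, J₂₄, J₃₄]) 0) := by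
  have hdet := hQ.det_nonneg
  have hminors := Finset.sum_nonneg (s := Finset.univ) fun (i : Fin 4) _ =>
    (hQ.submatrix i.succAbove).det_nonneg
  rw [det_Qmat, Complex.zero_le_real] at hdet
  rw [sum_det_principal_minors_Qmat, Complex.zero_le_real] at hminors
  have hE := (abs_nonneg c₄).trans (abs_le_of_Qmat_posSemidef hQ)
  have hD := add_nonneg (dot3_self_nonneg
    ![c₄ * c₁' - c₄' * c₁, c₄ * c₂' - c₄' * c₂, c₄ * c₃' - c₄' * c₃])
    (dot3_self_nonneg (cross3 ![c₁, c₂, c₃] ![J₂₃, -J₁₃, J₁₂]))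
  have hT := (dot3_add_dot3_sq_le
    ![c₄ * c₁' - c₄' * c₁, c₄ * c₂' - c₄' * c₂, c₄ * c₃' - c₄' * c₃] ![J₁₄, J₂₄, J₃₄]
    (cross3 ![c₁, c₂, c₃] ![J₂₃, -J₁₃, J₁₂]) ![c₁', c₂', c₃']).trans
      (mul_le_mul_of_nonneg_left (dot3_add_dot3_le_of_Qmat_posSemidef hQ) hD)
  have hW : (c₄ * c₁' - c₄' * c₁) ^ 2 + (c₄ * c₂' - c₄' * c₂) ^ 2 + (c₄ * c₃' - c₄' * c₃) ^ 2 =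
      dot3 ![c₄ * c₁' - c₄' * c₁, c₄ * c₂' - c₄' * c₂, c₄ * c₃' - c₄' * c₃]
        ![c₄ * c₁' - c₄' * c₁, c₄ * c₂' - c₄' * c₂, c₄ * c₃' - c₄' * c₃] := by
    simp only [dot3, Matrix.cons_val]
    ring
  simp only [norm3_sq, hW]
  refine le_of_eq_of_le ?_ (sq_ge_of_quartic_nonneg hE (sum_sq_eq_zero_of_Qmat_posSemidef hQ)
    hD hT hminors hdet)
  congr 3
  ring
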